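/- arXiv:1208.0974 — 12 statements merged into one kernel-verified Lean document; each statement's English description precedes it below -/
import Mathlib

section
/- Let A = (a_ij) be a symmetric n × n matrix with integer entries and let q(x) = Σ_{1≤i,j≤n} a_ij x_i x_j be the associated quadratic form, assumed positive definite (q(x) > 0 for all nonzero x ∈ ℚⁿ). Suppose that for every x ∈ ℚⁿ there exists y ∈ ℤⁿ with q(x − y) < 1. Then for every d ∈ ℤ, if there exists x ∈ ℚⁿ with q(x) = d, there exists y ∈ ℤⁿ with q(y) = d. -/
open scoped BigOperators

/-- Expansion of the quadratic form on an integral combination of two vectors. -/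
theorem adc_expand {n : ℕ} (A : Matrix (Fin n) (Fin n) ℤ) (hsymm : A.IsSymm)
    (u v : Fin n → ℤ) (a b : ℤ) :
    ∑ i, ∑ j, A i j * (a * u i + b * v i) * (a * u j + b * v j)
      = a ^ 2 * (∑ i, ∑ j, A i j * u i * u j) + 2 * a * b * (∑ i, ∑ j, A i j * u i * v j)
        + b ^ 2 * (∑ i, ∑ j, A i j * v i * v j) := by
  have h : ∑ i, ∑ j, A i j * v i * u j = ∑ i, ∑ j, A i j * u i * v j := by
    rw [Finset.sum_comm]
    refine Finset.sum_congr rfl fun i _ => Finset.sum_congr rfl fun j _ => ?_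
    rw [hsymm.apply i j]
    ring
  have h2 : ∑ i, ∑ j, A i j * (a * u i + b * v i) * (a * u j + b * v j)
      = a ^ 2 * (∑ i, ∑ j, A i j * u i * u j) + a * b * (∑ i, ∑ j, A i j * u i * v j)
        + a * b * (∑ i, ∑ j, A i j * v i * u j)
        + b ^ 2 * (∑ i, ∑ j, A i j * v i * v j) := by
    simp only [Finset.mul_sum, ← Finset.sum_add_distrib]
    refine Finset.sum_congr rfl fun i _ => Finset.sum_congr rfl fun j _ => ?_
    ring
  rw [h2, h]
  ring

/-- The descent step, by strong induction on the common denominator. -/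
theorem adc_descent {n : ℕ} (A : Matrix (Fin n) (Fin n) ℤ)
    (hsymm : A.IsSymm)
    (hpos : ∀ x : Fin n → ℚ, x ≠ 0 → 0 < ∑ i, ∑ j, (A i j : ℚ) * x i * x j)
    (heuc : ∀ x : Fin n → ℚ, ∃ y : Fin n → ℤ,
      (∑ i, ∑ j, (A i j : ℚ) * (x i - (y i : ℚ)) * (x j - (y j : ℚ))) < 1)
    (d : ℤ) (t : ℕ) : 0 < t → ∀ X : Fin n → ℤ,
      ∑ i, ∑ j, A i j * X i * X j = (t : ℤ) ^ 2 * d →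
      ∃ y : Fin n → ℤ, ∑ i, ∑ j, A i j * y i * y j = d := by
  induction t using Nat.strong_induction_on with
  | _ t ih =>
  intro ht X hX
  obtain ⟨y, hy⟩ := heuc (fun i => (X i : ℚ) / t)
  have htQ : (0 : ℚ) < t := by exact_mod_cast ht
  have htZ : (0 : ℤ) < t := by exact_mod_cast ht
  have hz := adc_expand A hsymm X y 1 (-(t : ℤ))
  have hlt : ∑ i, ∑ j, A i j * (1 * X i + -(t : ℤ) * y i) * (1 * X j + -(t : ℤ) * y j)
      < (t : ℤ) ^ 2 := by
    have h1 : ((∑ i, ∑ j, A i j * (1 * X i + -(t : ℤ) * y i) * (1 * X j + -(t : ℤ) * y j) : ℤ) : ℚ)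
        = (t : ℚ) ^ 2 * ∑ i, ∑ j, (A i j : ℚ) * ((X i : ℚ) / t - (y i : ℚ))
          * ((X j : ℚ) / t - (y j : ℚ)) := by
      push_cast
      simp only [Finset.mul_sum]
      refine Finset.sum_congr rfl fun i _ => Finset.sum_congr rfl fun j _ => ?_
      field_simp
      ring
    have h2 : ((∑ i, ∑ j, A i j * (1 * X i + -(t : ℤ) * y i) * (1 * X j + -(t : ℤ) * y j) : ℤ) : ℚ)
        < (t : ℚ) ^ 2 := by
      rw [h1]
      exact mul_lt_of_lt_one_right (by positivity) hy
    exact_mod_cast h2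
  by_cases h0 : ∀ i, X i = t * y i
  · refine ⟨y, ?_⟩
    have h3 : ∑ i, ∑ j, A i j * X i * X j = (t : ℤ) ^ 2 * ∑ i, ∑ j, A i j * y i * y j := by
      simp only [Finset.mul_sum]
      refine Finset.sum_congr rfl fun i _ => Finset.sum_congr rfl fun j _ => ?_
      rw [h0 i, h0 j]
      ring
    rw [h3] at hX
    exact mul_left_cancel₀ (by positivity) hX
  · have hgt : 0 < ∑ i, ∑ j, A i j * (1 * X i + -(t : ℤ) * y i)
        * (1 * X j + -(t : ℤ) * y j) := by
      have h4 := hpos (fun i => ((1 * X i + -(t : ℤ) * y i : ℤ) : ℚ)) (by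
        intro h
        apply h0
        intro i
        have h5 := congrFun h i
        simp only [Pi.zero_apply, Int.cast_eq_zero] at h5
        linarith)
      exact_mod_cast h4
    rw [hz] at hlt hgt
    rw [hX] at hlt hgt
    have hX2 := adc_expand A hsymm X y ((∑ i, ∑ j, A i j * y i * y j) - d)
      (2 * (d * t - ∑ i, ∑ j, A i j * X i * y j))
    rw [hX] at hX2
    generalize (∑ i, ∑ j, A i j * y i * y j) = Q at *
    generalize (∑ i, ∑ j, A i j * X i * y j) = B at *
    obtain ⟨s, hs⟩ : ∃ s : ℤ, s = (Q - d) * t + 2 * (d * t - B) := ⟨_, rfl⟩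
    have hts : 1 ^ 2 * ((t : ℤ) ^ 2 * d) + 2 * 1 * -(t : ℤ) * B + (-(t : ℤ)) ^ 2 * Q
        = t * s := by
      rw [hs]
      ring
    rw [hts] at hlt hgt
    have hs0 : 0 < s := pos_of_mul_pos_right hgt htZ.le
    have hst : s < t := by
      rw [sq] at hlt
      exact lt_of_mul_lt_mul_left hlt htZ.le
    lift s to ℕ using hs0.le
    refine ih s (by exact_mod_cast hst) (by exact_mod_cast hs0) _ (hX2.trans ?_)
    rw [hs]
    ring

/-- **Aubry–Davenport–Cassels Theorem.** Let `A` be a symmetric `n × n` integer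
matrix whose associated quadratic form `q(x) = ∑ᵢⱼ aᵢⱼ xᵢ xⱼ` is positive
definite over `ℚ`.  If for every `x ∈ ℚⁿ` there is `y ∈ ℤⁿ` with `q(x - y) < 1`,
then every integer that is rationally represented by `q` is integrally
represented by `q`. -/
theorem aubry_davenport_cassels {n : ℕ} (A : Matrix (Fin n) (Fin n) ℤ)
    (hsymm : A.IsSymm)
    (hpos : ∀ x : Fin n → ℚ, x ≠ 0 → 0 < ∑ i, ∑ j, (A i j : ℚ) * x i * x j)
    (heuc : ∀ x : Fin n → ℚ, ∃ y : Fin n → ℤ,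
      (∑ i, ∑ j, (A i j : ℚ) * (x i - (y i : ℚ)) * (x j - (y j : ℚ))) < 1)
    (d : ℤ) (hd : ∃ x : Fin n → ℚ, ∑ i, ∑ j, (A i j : ℚ) * x i * x j = (d : ℚ)) :
    ∃ y : Fin n → ℤ, ∑ i, ∑ j, A i j * y i * y j = d := by
  obtain ⟨x, hx⟩ := hd
  obtain ⟨b, hb⟩ := IsLocalization.exist_integer_multiples_of_finite (nonZeroDivisors ℤ) x
  choose X hX using hb
  have hb0 : (b : ℤ) ≠ 0 := nonZeroDivisors.coe_ne_zero b
  refine adc_descent A hsymm hpos heuc d (b : ℤ).natAbs (Int.natAbs_pos.mpr hb0) X ?_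
  rw [Int.natAbs_sq]
  have hX' : ∀ i, (X i : ℚ) = ((b : ℤ) : ℚ) * x i := by
    intro i
    have h := hX i
    simpa using h
  have h : ((∑ i, ∑ j, A i j * X i * X j : ℤ) : ℚ) = (((b : ℤ) ^ 2 * d : ℤ) : ℚ) := by
    push_cast
    rw [← hx]
    simp only [Finset.mul_sum, hX']
    refine Finset.sum_congr rfl fun i _ => Finset.sum_congr rfl fun j _ => ?_
    ring
  exact_mod_cast h
end

section
/- An integer n is a sum of three squares of integers if and only if n ≥ 0 and n is not of the form 4^a(8k + 7) with a, k ∈ ℕ. -/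
lemma exists_shift (A B : ℤ) (hA : 0 < A) : ∃ k : ℤ, 4 * (B + k * A) ^ 2 ≤ A ^ 2 := by
  refine ⟨-((2 * B + A) / (2 * A)), ?_⟩
  have h1 := Int.emod_add_mul_ediv (2 * B + A) (2 * A)
  have h2 := Int.emod_nonneg (2 * B + A) (b := 2 * A) (by omega)
  have h3 := Int.emod_lt_of_pos (2 * B + A) (b := 2 * A) (by omega)
  set q := (2 * B + A) / (2 * A)
  set r := (2 * B + A) % (2 * A)
  have : 2 * (B + -q * A) = r - A := by linarith
  nlinarith

lemma form_sum (a A : ℕ) : ∀ b c d e f : ℤ, 0 < a → 0 < A → (a : ℤ) * b - f ^ 2 = A →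
    a * b * c + 2 * d * e * f - a * d ^ 2 - b * e ^ 2 - c * f ^ 2 = 1 →
    ∀ x y z : ℤ, ∃ u v w : ℤ,
      a * x ^ 2 + b * y ^ 2 + c * z ^ 2 + 2 * d * y * z + 2 * e * x * z + 2 * f * x * y
        = u ^ 2 + v ^ 2 + w ^ 2 := by
  induction a using Nat.strong_induction_on generalizing A with
  | _ a iha =>
  induction A using Nat.strong_induction_on with
  | _ A ihA =>
  intro b c d e f ha hA hAb hdet x y z
  have ha' : (0 : ℤ) < a := by exact_mod_cast ha
  have hA' : (0 : ℤ) < A := by exact_mod_cast hA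
  by_cases h : 3 * (A : ℤ) ^ 2 ≤ 4 * a
  · obtain ⟨k, hk⟩ := exists_shift a f ha'
    have hb1 : (a : ℤ) * (b + 2 * k * f + k ^ 2 * a) = A + (f + k * a) ^ 2 := by
      rw [← hAb]; ring
    generalize hb' : b + 2 * k * f + k ^ 2 * a = b' at hb1
    have hb0 : 0 < b' := by
      by_contra hcon
      nlinarith [sq_nonneg (f + k * a)]
    by_cases hlt : b' < a
    · lift b' to ℕ using hb0.le with B
      obtain ⟨u, v, w, huv⟩ := iha B (by exact_mod_cast hlt) A a c e (d + k * e) (f + k * a)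
        (by exact_mod_cast hb0) hA (by linarith) (by rw [← hb', ← hdet]; ring) y (x - k * y) z
      refine ⟨u, v, w, ?_⟩
      rw [← huv, ← hb']; ring
    · push Not at hlt
      have h1 : 3 * (a : ℤ) ^ 2 ≤ 4 * A := by nlinarith
      have ha1 : (a : ℤ) = 1 := by
        by_contra hne
        have h2 : (2 : ℤ) ≤ a := by omega
        have h3 : 9 * (a : ℤ) ^ 4 ≤ 16 * A ^ 2 := by nlinarith [sq_nonneg (a : ℤ)]
        have h4 : 27 * (a : ℤ) ^ 4 ≤ 64 * a := by linarith
        have h5 : 27 * (a : ℤ) ^ 3 ≤ 64 := by nlinarith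
        have h6 : (2 : ℤ) ^ 3 ≤ a ^ 3 := pow_le_pow_left₀ (by norm_num) h2 3
        linarith
      have hA1 : (A : ℤ) = 1 := by
        rw [ha1] at h
        nlinarith
      rw [ha1, hA1] at hAb
      rw [ha1] at hdet ⊢
      have hb : b = 1 + f ^ 2 := by linarith
      subst hb
      have hc : c = 1 + e ^ 2 + (d - e * f) ^ 2 := by linear_combination hdet
      subst hc
      exact ⟨x + f * y + e * z, y + (d - e * f) * z, z, by ring⟩
  · push Not at h
    obtain ⟨k, hk⟩ := exists_shift A (a * d - e * f) hA'
    have hC : (A : ℤ) * (a * (c + 2 * k * d + k ^ 2 * b) - (e + k * f) ^ 2)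
        = a + (a * d - e * f + k * A) ^ 2 := by
      rw [← hAb]; linear_combination (a : ℤ) * hdet
    generalize hC' : a * (c + 2 * k * d + k ^ 2 * b) - (e + k * f) ^ 2 = C at hC
    have hC0 : 0 < C := by
      by_contra hcon
      nlinarith [sq_nonneg (a * d - e * f + k * A)]
    have hClt : C < A := by
      by_contra hcon
      nlinarith
    lift C to ℕ using hC0.le
    obtain ⟨u, v, w, huv⟩ := ihA C (by exact_mod_cast hClt) (c + 2 * k * d + k ^ 2 * b) b
      (d + k * b) f (e + k * f) ha (by exact_mod_cast hC0) hC' (by rw [← hdet]; ring)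
      x z (y - k * z)
    refine ⟨u, v, w, ?_⟩
    rw [← huv]; ring

lemma key (n d t : ℤ) (hd : 0 < d) (hdn : 1 < d * n) (h : (d * n - 1) ∣ t ^ 2 + d) :
    ∃ x y z : ℤ, n = x ^ 2 + y ^ 2 + z ^ 2 := by
  obtain ⟨a, ha⟩ := h
  have ha0 : 0 < a := by
    by_contra hcon
    nlinarith [sq_nonneg t]
  lift a to ℕ using ha0.le
  lift d to ℕ using hd.le
  obtain ⟨u, v, w, h⟩ := form_sum a d (d * n - 1) n 0 1 t (by exact_mod_cast ha0)
    (by exact_mod_cast hd) (by linarith) (by linear_combination -n*ha) 0 0 1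
  exact ⟨u, v, w, by rw [← h]; ring⟩

lemma exists_prime_form (m r : ℕ) (hm : m ≠ 0) (h : r.Coprime m) :
    ∃ v p : ℕ, 0 < v ∧ p.Prime ∧ p = m * v + r := by
  obtain ⟨p, hp, hpp, hmod⟩ := Nat.forall_exists_prime_gt_and_modEq r hm h
  have := (Nat.modEq_iff_dvd' hp.le).1 hmod.symm
  obtain ⟨v, hv⟩ := this
  refine ⟨v, p, ?_, hpp, by omega⟩
  rcases Nat.eq_zero_or_pos v with rfl | h
  · omega
  · exact h

open NumberTheorySymbols in
lemma dvd_of_jacobi (p : ℕ) (hp : p.Prime) (d : ℤ) (h : J(-d | p) = 1) :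
    ∃ t : ℤ, (p : ℤ) ∣ t ^ 2 + d := by
  have := Fact.mk hp
  obtain ⟨s, hs⟩ := ZMod.isSquare_of_jacobiSym_eq_one h
  refine ⟨s.valMinAbs, ?_⟩
  rw [← ZMod.intCast_zmod_eq_zero_iff_dvd]
  push_cast at hs ⊢
  rw [← sq] at hs
  rw [← hs]
  ring

open NumberTheorySymbols in
lemma jacobi_swap (p d : ℕ) (hd : Odd d) (hp : Odd p) (h : p % 4 = 1 ∨ d % 4 = 3) :
    J(-(d : ℤ) | p) = J((p : ℤ) | d) := by
  rw [jacobiSym.neg _ hp]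
  by_cases h1 : p % 4 = 1
  · rw [ZMod.χ₄_nat_one_mod_four h1, one_mul, jacobiSym.quadratic_reciprocity_one_mod_four' hd h1]
  · have h3 : p % 4 = 3 := by
      have := Nat.odd_iff.1 hp
      omega
    rw [ZMod.χ₄_nat_three_mod_four h3,
      jacobiSym.quadratic_reciprocity_three_mod_four (by omega) h3]
    ring

lemma case_even (n : ℕ) (hn : n % 4 = 2) : ∃ x y z : ℤ, (n : ℤ) = x ^ 2 + y ^ 2 + z ^ 2 := by
  have hcop : (n - 1).Coprime (4 * n) := by
    apply Nat.Coprime.mul_right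
    · have h2 : (n - 1).Coprime 2 := by
        rw [Nat.coprime_two_right, Nat.odd_iff]; omega
      exact h2.pow_right 2
    · have := Nat.coprime_self_add_right (m := n - 1) (n := 1)
      rw [show n - 1 + 1 = n by omega] at this
      simp [this]
  obtain ⟨v, p, hv, hp, hpv⟩ := exists_prime_form (4 * n) (n - 1) (by omega) hcop
  have hpe : p + 1 = (4 * v + 1) * n := by
    have : 4 * n * v + n = (4 * v + 1) * n := by ring
    omega
  have hp4 : p % 4 = 1 := by
    rw [hpv, mul_assoc]; omega
  have hdodd : Odd (4 * v + 1) := by rw [Nat.odd_iff]; omega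
  have hpodd : Odd p := by rw [Nat.odd_iff]; omega
  have hJ : jacobiSym (-((4 * v + 1 : ℕ) : ℤ)) p = 1 := by
    rw [jacobi_swap _ _ hdodd hpodd (Or.inl hp4)]
    have : jacobiSym (p : ℤ) (4 * v + 1) = jacobiSym (-1) (4 * v + 1) := by
      apply jacobiSym.mod_left'
      apply Int.ModEq.symm
      rw [Int.modEq_iff_dvd]
      exact ⟨n, by rw [sub_neg_eq_add]; exact_mod_cast hpe⟩
    rw [this, jacobiSym.at_neg_one hdodd, ZMod.χ₄_nat_one_mod_four (by omega)]
  obtain ⟨t, ht⟩ := dvd_of_jacobi p hp _ hJ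
  have hpe' : (p : ℤ) + 1 = ((4 * v + 1 : ℕ) : ℤ) * n := by exact_mod_cast hpe
  have := hp.pos
  refine key n ((4 * v + 1 : ℕ) : ℤ) t (by positivity) (by omega) ?_
  rwa [← hpe', add_sub_cancel_right]

lemma case_odd (n c r : ℕ) (h : c * n = 2 * r + 1) (hr : r % 2 = 1) (hc : c = 1 ∨ c = 3)
    (hrc : r % 4 = 1 ∨ c = 3) : ∃ x y z : ℤ, (n : ℤ) = x ^ 2 + y ^ 2 + z ^ 2 := by
  have hn : n ≠ 0 := by rintro rfl; omega
  have hcop : r.Coprime (4 * n) := by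
    apply Nat.Coprime.mul_right
    · have h2 : r.Coprime 2 := by
        rw [Nat.coprime_two_right, Nat.odd_iff]; omega
      exact h2.pow_right 2
    · have h1 : r.Coprime (c * n) := by
        rw [h, mul_comm]; simp
      exact h1.coprime_mul_left_right
  obtain ⟨v, p, hv, hp, hpv⟩ := exists_prime_form (4 * n) r (by omega) hcop
  have hpe : 2 * p + 1 = (8 * v + c) * n := by
    rw [hpv]; linarith
  have hp4 : p % 4 = r % 4 := by
    rw [hpv, mul_assoc]; omega
  generalize hd : 8 * v + c = d at hpe
  have hdodd : Odd d := by rw [Nat.odd_iff]; omega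
  have hpodd : Odd p := by rw [Nat.odd_iff]; omega
  have hpe' : 2 * (p : ℤ) + 1 = (d : ℤ) * n := by exact_mod_cast hpe
  have hJ : jacobiSym (-(d : ℤ)) p = 1 := by
    rw [jacobi_swap _ _ hdodd hpodd (by omega)]
    have h1 : jacobiSym (-2) d = 1 := by
      rw [jacobiSym.at_neg_two hdodd, ZMod.χ₈'_nat_eq_if_mod_eight, if_neg (by omega),
        if_pos (by omega)]
    have h2 : jacobiSym (-2 * (p : ℤ)) d = jacobiSym 1 d := by
      apply jacobiSym.mod_left'
      apply Int.ModEq.symm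
      rw [Int.modEq_iff_dvd]
      exact ⟨-n, by linarith⟩
    rw [jacobiSym.mul_left, h1, one_mul, jacobiSym.one_left] at h2
    exact h2
  obtain ⟨t, ht⟩ := dvd_of_jacobi p hp _ hJ
  have hp0 := hp.pos
  have hd2 : (d : ℤ) % 2 = 1 := by have := Nat.odd_iff.1 hdodd; omega
  have hp2 : (p : ℤ) % 2 = 1 := by have := Nat.odd_iff.1 hpodd; omega
  obtain ⟨s, hs, hs2⟩ : ∃ s : ℤ, (p : ℤ) ∣ s ^ 2 + d ∧ s % 2 = 1 := by
    rcases Int.emod_two_eq_zero_or_one t with h0 | h1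
    · refine ⟨t + p, ?_, by omega⟩
      have : (t + p) ^ 2 + (d : ℤ) = (t ^ 2 + d) + p * (2 * t + p) := by ring
      rw [this]
      exact dvd_add ht (dvd_mul_right _ _)
    · exact ⟨t, ht, h1⟩
  have h2 : (2 : ℤ) ∣ s ^ 2 + d := by
    apply Int.dvd_of_emod_eq_zero
    rw [Int.add_emod, sq, Int.mul_emod, hs2, hd2]; norm_num
  have hcop2 : IsCoprime (2 : ℤ) p := by
    rw [Int.isCoprime_iff_gcd_eq_one]
    exact (Nat.coprime_two_left).2 hpodd
  refine key n d s (by omega) (by omega) ?_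
  rw [← hpe', add_sub_cancel_right]
  exact hcop2.mul_dvd h2 hs

lemma three_squares_nat (n : ℕ) (h : ¬ ∃ a k : ℕ, n = 4 ^ a * (8 * k + 7)) :
    ∃ x y z : ℤ, (n : ℤ) = x ^ 2 + y ^ 2 + z ^ 2 := by
  induction n using Nat.strong_induction_on with
  | _ n ih =>
  rcases Nat.eq_zero_or_pos n with rfl | hn
  · exact ⟨0, 0, 0, by norm_num⟩
  by_cases h4 : n % 4 = 0
  · obtain ⟨m, rfl⟩ := Nat.dvd_of_mod_eq_zero h4
    obtain ⟨x, y, z, hx⟩ := ih m (by omega) (by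
      rintro ⟨a, k, rfl⟩
      exact h ⟨a + 1, k, by ring⟩)
    exact ⟨2 * x, 2 * y, 2 * z, by push_cast; rw [hx]; ring⟩
  have h7 : n % 8 ≠ 7 := fun h7 => h ⟨0, n / 8, by omega⟩
  by_cases h2 : n % 4 = 2
  · exact case_even n h2
  by_cases h3 : n % 8 = 3
  · exact case_odd n 1 (n / 2) (by omega) (by omega) (by omega) (by omega)
  · exact case_odd n 3 (3 * n / 2) (by omega) (by omega) (by omega) (by omega)

lemma not_form (a k : ℕ) : ∀ x y z : ℤ, x ^ 2 + y ^ 2 + z ^ 2 ≠ 4 ^ a * (8 * k + 7) := by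
  have sq8 : ∀ x : ℤ, (x % 2 = 0 ∧ (x ^ 2 % 8 = 0 ∨ x ^ 2 % 8 = 4)) ∨ x ^ 2 % 8 = 1 := by
    intro x
    have : x % 8 = 0 ∨ x % 8 = 1 ∨ x % 8 = 2 ∨ x % 8 = 3 ∨ x % 8 = 4 ∨ x % 8 = 5 ∨ x % 8 = 6 ∨
      x % 8 = 7 := by omega
    rcases this with h | h | h | h | h | h | h | h <;> simp [sq, Int.mul_emod, h] <;> omega
  induction a with
  | zero =>
    intro x y z h
    have := sq8 x
    have := sq8 y
    have := sq8 z
    omega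
  | succ a ih =>
    intro x y z h
    rw [pow_succ 4, mul_comm _ (4 : ℤ), mul_assoc] at h
    have h1 := sq8 x
    have h2 := sq8 y
    have h3 := sq8 z
    generalize hM : (4 : ℤ) ^ a * (8 * k + 7) = M at h
    have hx : x % 2 = 0 ∧ y % 2 = 0 ∧ z % 2 = 0 := by omega
    obtain ⟨⟨x', rfl⟩, ⟨y', rfl⟩, ⟨z', rfl⟩⟩ := hx.imp Int.dvd_of_emod_eq_zero
      (And.imp Int.dvd_of_emod_eq_zero Int.dvd_of_emod_eq_zero)
    exact ih x' y' z' (by rw [hM]; linarith)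

/-- **Gauss–Legendre Three Squares Theorem.** An integer `n` is a sum of three
integer squares iff `n ≥ 0` and `n` is not of the form `4^a * (8k + 7)`. -/
theorem three_squares (n : ℤ) :
    (∃ x y z : ℤ, n = x ^ 2 + y ^ 2 + z ^ 2) ↔
      (0 ≤ n ∧ ¬ ∃ a k : ℕ, n = 4 ^ a * (8 * k + 7)) := by
  constructor
  · rintro ⟨x, y, z, rfl⟩
    refine ⟨by positivity, ?_⟩
    rintro ⟨a, k, h⟩
    exact not_form a k x y z h
  · rintro ⟨h0, h⟩
    lift n to ℕ using h0
    apply three_squares_nat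
    rintro ⟨a, k, hk⟩
    exact h ⟨a, k, by rw [hk]; push_cast; rfl⟩
end

section
/- Let F be a field of characteristic not 2 and let q be a quadratic form in n variables with coefficients in F, viewed by base extension as a quadratic form over the polynomial ring F[t]. If d ∈ F[t] is such that there exists x = (x_1, …, x_n) ∈ F(t)ⁿ with q(x) = d, then there exists y = (y_1, …, y_n) ∈ F[t]ⁿ with q(y) = d. -/
open scoped BigOperators

namespace CP

open Polynomial

/-- The quadratic form attached to a matrix. -/
def Q {R : Type*} [CommRing R] {n : ℕ} (A : Matrix (Fin n) (Fin n) R) (x : Fin n → R) : R :=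
  ∑ i, ∑ j, A i j * x i * x j

/-- The linear forms giving the polar form. -/
def L {R : Type*} [CommRing R] {n : ℕ} (A : Matrix (Fin n) (Fin n) R) (x : Fin n → R)
    (i : Fin n) : R := ∑ j, (A i j + A j i) * x j

/-- The polar form. -/
def B {R : Type*} [CommRing R] {n : ℕ} (A : Matrix (Fin n) (Fin n) R) (x y : Fin n → R) : R :=
  ∑ i, y i * L A x i

section
variable {R : Type*} [CommRing R] {n : ℕ} (A : Matrix (Fin n) (Fin n) R)

lemma Q_comb (x y : Fin n → R) (s t : R) :
    Q A (fun i => s * x i + t * y i) = s ^ 2 * Q A x + s * t * B A x y + t ^ 2 * Q A y := by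
  have hB : B A x y = ∑ i, ∑ j, (A i j * x i * y j + A i j * x j * y i) := by
    simp only [B, L, Finset.mul_sum, add_mul, mul_add, Finset.sum_add_distrib]
    rw [add_comm]
    congr 1
    · rw [Finset.sum_comm]
      exact Finset.sum_congr rfl fun i _ => Finset.sum_congr rfl fun j _ => by ring
    · exact Finset.sum_congr rfl fun i _ => Finset.sum_congr rfl fun j _ => by ring
  rw [hB]
  simp only [Q, Finset.mul_sum, ← Finset.sum_add_distrib]
  exact Finset.sum_congr rfl fun i _ => Finset.sum_congr rfl fun j _ => by ring

lemma Q_smul (x : Fin n → R) (s : R) : Q A (fun i => s * x i) = s ^ 2 * Q A x := by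
  have := Q_comb A x x s 0
  simpa using this

lemma Q_map {S : Type*} [CommRing S] (f : R →+* S) (x : Fin n → R) :
    Q (A.map f) (fun i => f (x i)) = f (Q A x) := by
  simp [Q]

lemma L_map {S : Type*} [CommRing S] (f : R →+* S) (x : Fin n → R) (i : Fin n) :
    L (A.map f) (fun i => f (x i)) i = f (L A x i) := by
  simp [L]

lemma L_comb (x y : Fin n → R) (s t : R) (k : Fin n) :
    L A (fun i => s * x i + t * y i) k = s * L A x k + t * L A y k := by
  simp only [L, Finset.mul_sum, ← Finset.sum_add_distrib]
  exact Finset.sum_congr rfl fun i _ => by ring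

lemma B_single (x : Fin n → R) (i : Fin n) : B A x (Pi.single i 1) = L A x i := by
  simp [B, Pi.single_apply]

end

variable {F : Type*} [Field F] {n : ℕ} (a : Matrix (Fin n) (Fin n) F)

/-- An isotropic vector outside the radical makes the form universal. -/
lemma univ (v : Fin n → F) (hv : Q a v = 0) (i : Fin n) (hi : L a v i ≠ 0) (d : F[X]) :
    ∃ y : Fin n → F[X], Q (a.map C) y = d := by
  set w : Fin n → F[X] := Pi.single i 1 with hw
  refine ⟨fun k => (C (L a v i)⁻¹ * (d - Q (a.map C) w)) * C (v k) + 1 * w k, ?_⟩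
  have h := Q_comb (a.map C) (fun k => C (v k)) w (C (L a v i)⁻¹ * (d - Q (a.map C) w)) 1
  rw [h, Q_map, hv, hw, B_single, L_map, ← hw]
  have h1 : C (L a v i)⁻¹ * C (L a v i) = 1 := by
    rw [← C_mul, inv_mul_cancel₀ hi, C_1]
  simp only [map_zero]
  linear_combination (d - Q (a.map C) w) * h1

lemma rad (H : ∀ v : Fin n → F, Q a v = 0 → ∀ i, L a v i = 0) (m : ℕ) :
    ∀ r : Fin n → F[X], (∀ i, (r i).natDegree < m) → Q (a.map C) r = 0 →
      ∀ i, L (a.map C) r i = 0 := by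
  induction m with
  | zero =>
    intro r hr _ i
    exact absurd (hr i) (Nat.not_lt_zero _)
  | succ m ih =>
    intro r hr hQ
    have h0 : Q a (fun i => (r i).coeff 0) = 0 := by
      have h := congrArg (fun p => p.coeff 0) hQ
      simpa [Q, mul_coeff_zero, finsetSum_coeff] using h
    have hL := H _ h0
    have hLC : ∀ i, L (a.map C) (fun i => C ((r i).coeff 0)) i = 0 := by
      intro i
      rw [L_map a C (fun i => (r i).coeff 0), hL, map_zero]
    have hc := Q_comb (a.map C) (fun i => C ((r i).coeff 0)) (fun i => (r i).divX) 1 X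
    have hre' : r = fun i => 1 * C ((r i).coeff 0) + X * (r i).divX := by
      funext i
      rw [one_mul, add_comm, X_mul_divX_add]
    rw [← hre', hQ, Q_map a C (fun i => (r i).coeff 0), h0, B] at hc
    simp only [hLC] at hc
    have hQd : Q (a.map C) (fun i => (r i).divX) = 0 := by
      simpa using hc
    intro i
    by_cases hm : m = 0
    · have : r = fun i => C ((r i).coeff 0) := by
        funext k
        exact eq_C_of_natDegree_eq_zero (by have := hr k; omega)
      rw [this]
      exact hLC i
    · have hd := ih (fun i => (r i).divX) (fun k => by
        have := hr k
        rw [natDegree_divX_eq_natDegree_tsub_one]; omega) hQd i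
      rw [hre', L_comb, hLC, hd]; simp

lemma descent (d : F[X]) (m : ℕ) : ∀ (f : F[X]) (x : Fin n → F[X]), f ≠ 0 → f.natDegree = m →
    Q (a.map C) x = d * f ^ 2 → ∃ y : Fin n → F[X], Q (a.map C) y = d := by
  induction m using Nat.strong_induction_on with
  | _ m ih =>
  intro f x hf hm hx
  set A := a.map C with hA
  by_cases H : ∀ v : Fin n → F, Q a v = 0 → ∀ i, L a v i = 0
  swap
  · push Not at H
    obtain ⟨v, hv, i, hi⟩ := H
    exact univ a v hv i hi d
  set y : Fin n → F[X] := fun i => x i / f with hy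
  set r : Fin n → F[X] := fun i => x i % f with hr
  have hxe : x = fun i => 1 * r i + f * y i := by
    funext i
    simp only [hy, hr]
    rw [one_mul, EuclideanDomain.mod_add_div]
  have hc := Q_comb A r y 1 f
  rw [← hxe, hx] at hc
  by_cases hyd : Q A y = d
  · exact ⟨y, hyd⟩
  have hdeg : ∀ i, (r i).degree < f.degree := fun i => EuclideanDomain.mod_lt _ hf
  set g := d * f - B A r y - f * Q A y with hg
  have hfg : Q A r = f * g := by rw [hg]; linear_combination -hc
  have hdr : ∀ i, (r i).natDegree ≤ m - 1 ∧ (m = 0 → r i = 0) := by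
    intro i
    have h := hdeg i
    rw [degree_eq_natDegree hf, hm] at h
    by_cases h0 : r i = 0
    · simp [h0]
    · rw [degree_eq_natDegree h0] at h
      have : (r i).natDegree < m := by exact_mod_cast h
      exact ⟨by omega, by omega⟩
  by_cases hg0 : g = 0
  · exfalso
    have hB : B A r y = 0 := by
      have := rad a H (m - 1 + 1) r (fun i => by have := (hdr i).1; omega) (by rw [hfg, hg0, mul_zero])
      simp [B, hA, this]
    rw [hg, hB] at hg0
    have : f * (Q A y - d) = 0 := by linear_combination -hg0
    rcases mul_eq_zero.1 this with h | h
    · exact hf h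
    · exact hyd (sub_eq_zero.1 h)
  · have hne : f * g ≠ 0 := mul_ne_zero hf hg0
    have hm0 : m ≠ 0 := by
      intro h0
      apply hne
      rw [← hfg]
      simp [Q, fun i => (hdr i).2 h0]
    have hle : (Q A r).natDegree ≤ (m - 1) + (m - 1) := by
      refine natDegree_sum_le_of_forall_le _ _ fun i _ =>
        natDegree_sum_le_of_forall_le _ _ fun j _ => ?_
      refine natDegree_mul_le_of_le ?_ (hdr j).1
      simp only [hA, Matrix.map_apply]
      exact (natDegree_C_mul_le _ _).trans (hdr i).1
    rw [hfg, natDegree_mul hf hg0, hm] at hle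
    refine ih g.natDegree (by omega) g (fun i => (Q A y - d) * r i + g * y i) hg0 rfl ?_
    rw [Q_comb, hfg]
    have hB : B A r y = d * f - f * Q A y - g := by rw [hg]; ring
    rw [hB]
    ring

end CP

/-- **Cassels–Pfister Theorem.** Let `F` be a field of characteristic not `2`
and `q(x) = ∑ᵢⱼ aᵢⱼ xᵢ xⱼ` a quadratic form with coefficients in `F`, viewed by
base extension as a quadratic form over `F[t]`.  If `d ∈ F[t]` is represented by
`q` over the rational function field `F(t)`, then `d` is represented by `q`
over `F[t]`. -/
theorem cassels_pfister {F : Type*} [Field F] (h2 : ringChar F ≠ 2) {n : ℕ}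
    (a : Matrix (Fin n) (Fin n) F) (d : Polynomial F)
    (hd : ∃ x : Fin n → RatFunc F,
      (∑ i, ∑ j, algebraMap F (RatFunc F) (a i j) * x i * x j)
        = algebraMap (Polynomial F) (RatFunc F) d) :
    ∃ y : Fin n → Polynomial F,
      (∑ i, ∑ j, Polynomial.C (a i j) * y i * y j) = d := by
  classical
  obtain ⟨x, hx⟩ := hd
  obtain ⟨b, hb⟩ := IsLocalization.exist_integer_multiples_of_finite
    (nonZeroDivisors (Polynomial F)) x
  choose z hz using hb
  refine CP.descent a d _ (b : Polynomial F) z (nonZeroDivisors.ne_zero b.2) rfl ?_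
  apply IsFractionRing.injective (Polynomial F) (RatFunc F)
  rw [← CP.Q_map]
  have h1 : (fun i => algebraMap (Polynomial F) (RatFunc F) (z i)) =
      fun i => algebraMap (Polynomial F) (RatFunc F) b * x i := by
    funext i
    rw [hz i, Algebra.smul_def]
  rw [h1, CP.Q_smul, map_mul, map_pow, ← hx, mul_comm]
  congr 1
end

section
/- Let F be a field of characteristic not 2 and fix a positive integer n. A polynomial d ∈ F[t] is a sum of n squares of elements of F(t) if and only if it is a sum of n squares of elements of F[t]. -/
open scoped BigOperators

/-- If the form is isotropic over `F`, every polynomial is a sum of squares. -/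
lemma cassels_isotropic {F : Type*} [Field F] (h2 : (2 : F) ≠ 0) {n : ℕ} (c : Fin n → F)
    (hc : ∑ i, c i ^ 2 = 0) (j : Fin n) (hj : c j ≠ 0) (d : Polynomial F) :
    ∃ s : Fin n → Polynomial F, d = ∑ i, s i ^ 2 := by
  classical
  set x : Polynomial F := Polynomial.C ((2 * c j)⁻¹) * (d - 1) with hx
  refine ⟨fun i => x * Polynomial.C (c i) + if i = j then 1 else 0, ?_⟩
  have h1 : ∀ i, (x * Polynomial.C (c i) + if i = j then 1 else 0) ^ 2 =
      x ^ 2 * Polynomial.C (c i ^ 2) +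
        (if i = j then 2 * x * Polynomial.C (c i) + 1 else 0) := by
    intro i
    split_ifs
    · rw [Polynomial.C_pow]; ring
    · rw [Polynomial.C_pow]; ring
  simp only [h1]
  rw [Finset.sum_add_distrib, ← Finset.mul_sum, ← map_sum, hc]
  have h3 : Polynomial.C ((2 * c j)⁻¹) * (2 * Polynomial.C (c j)) = (1 : Polynomial F) := by
    have : (2 : Polynomial F) = Polynomial.C 2 := (map_ofNat Polynomial.C 2).symm
    rw [this, ← Polynomial.C_mul, ← Polynomial.C_mul, inv_mul_cancel₀ (mul_ne_zero h2 hj),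
      Polynomial.C_1]
  simp only [Finset.sum_ite_eq', Finset.mem_univ, if_true, map_zero, mul_zero, zero_add]
  rw [hx]
  linear_combination (-(d - 1)) * h3

/-- The descent step. -/
lemma cassels_descent {F : Type*} [Field F] (h2 : (2 : F) ≠ 0) {n : ℕ} (d : Polynomial F)
    (N : ℕ) : ∀ (g : Polynomial F) (f : Fin n → Polynomial F), g ≠ 0 → g.natDegree = N →
      g ^ 2 * d = ∑ i, f i ^ 2 → ∃ s : Fin n → Polynomial F, d = ∑ i, s i ^ 2 := by
  classical
  induction N using Nat.strong_induction_on with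
  | _ N ih =>
  intro g f hg hN hgf
  by_cases hr : ∀ i, f i % g = 0
  · refine ⟨fun i => f i / g, ?_⟩
    apply mul_left_cancel₀ (pow_ne_zero 2 hg)
    rw [hgf, Finset.mul_sum]
    refine Finset.sum_congr rfl fun i _ => ?_
    have := EuclideanDomain.div_add_mod (f i) g
    rw [hr i, add_zero] at this
    rw [← mul_pow, this]
  push Not at hr
  obtain ⟨k, hk⟩ := hr
  by_cases hS : ∑ i, (f i % g) ^ 2 = 0
  · obtain ⟨j, -, hj⟩ := Finset.exists_max_image Finset.univ
      (fun i => (f i % g).degree) ⟨k, Finset.mem_univ k⟩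
    have hj0 : f j % g ≠ 0 := by
      intro h0
      have := hj k (Finset.mem_univ k)
      rw [h0, Polynomial.degree_zero, le_bot_iff, Polynomial.degree_eq_bot] at this
      exact hk this
    refine cassels_isotropic h2 (fun i => (f i % g).coeff (f j % g).natDegree) ?_ j ?_ d
    · have := congrArg (fun p => Polynomial.coeff p (2 * (f j % g).natDegree)) hS
      simp only [Polynomial.finsetSum_coeff, Polynomial.coeff_zero] at this
      rw [← this]
      refine Finset.sum_congr rfl fun i _ => ?_
      rw [Polynomial.coeff_pow_of_natDegree_le]
      exact Polynomial.natDegree_le_natDegree (hj i (Finset.mem_univ i))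
    · exact Polynomial.leadingCoeff_ne_zero.mpr hj0
  · set q : Fin n → Polynomial F := fun i => f i / g with hq
    set Q := ∑ i, q i ^ 2 with hQ
    set B := ∑ i, f i * q i with hB
    set a := Q - d with ha
    set b := 2 * (g * d - B) with hb
    have hgg : g * (a * g + b) = ∑ i, (f i % g) ^ 2 := by
      have h1 : ∀ i, (f i % g) ^ 2 = f i ^ 2 - 2 * g * (f i * q i) + g ^ 2 * q i ^ 2 := by
        intro i
        have : f i % g = f i - g * q i := by
          rw [eq_sub_iff_add_eq, add_comm]; exact EuclideanDomain.div_add_mod (f i) g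
        rw [this]; ring
      simp only [h1]
      rw [Finset.sum_add_distrib, Finset.sum_sub_distrib, ← Finset.mul_sum, ← Finset.mul_sum,
        ← hgf, ← hQ, ← hB, ha, hb]
      ring
    have hg' : a * g + b ≠ 0 := by
      intro h0
      rw [h0, mul_zero] at hgg
      exact hS hgg.symm
    have hdeg : (a * g + b).natDegree < N := by
      have hlt : (g * (a * g + b)).degree < (g * g).degree := by
        rw [hgg]
        refine (Polynomial.degree_sum_le _ _).trans_lt ?_
        rw [Finset.sup_lt_iff (by
          rw [bot_lt_iff_ne_bot, Ne, Polynomial.degree_eq_bot]; exact mul_ne_zero hg hg)]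
        intro i _
        by_cases h0 : f i % g = 0
        · rw [h0, zero_pow two_ne_zero, Polynomial.degree_zero, bot_lt_iff_ne_bot, Ne,
            Polynomial.degree_eq_bot]
          exact mul_ne_zero hg hg
        · have hl : (f i % g).natDegree < g.natDegree :=
            Polynomial.natDegree_lt_natDegree h0 (EuclideanDomain.mod_lt (f i) hg)
          apply Polynomial.degree_lt_degree
          rw [Polynomial.natDegree_pow, Polynomial.natDegree_mul hg hg]
          omega
      have := Polynomial.natDegree_lt_natDegree (mul_ne_zero hg hg') hlt
      rw [Polynomial.natDegree_mul hg hg, Polynomial.natDegree_mul hg hg'] at this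
      omega
    refine ih _ hdeg (a * g + b) (fun i => a * f i + b * q i) hg' rfl ?_
    have h1 : ∀ i, (a * f i + b * q i) ^ 2 =
        a ^ 2 * f i ^ 2 + 2 * a * b * (f i * q i) + b ^ 2 * q i ^ 2 := by
      intro i; ring
    simp only [h1]
    rw [Finset.sum_add_distrib, Finset.sum_add_distrib, ← Finset.mul_sum, ← Finset.mul_sum,
      ← Finset.mul_sum, ← hgf, ← hQ, ← hB, ha, hb]
    ring

/-- **Cassels' Theorem on sums of squares.** Let `F` be a field of
characteristic not `2` and `n ≥ 1`.  A polynomial `d ∈ F[t]` is a sum of `n`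
squares of rational functions iff it is a sum of `n` squares of polynomials. -/
theorem cassels_sums_of_squares {F : Type*} [Field F] (h2 : ringChar F ≠ 2)
    (n : ℕ) (hn : 1 ≤ n) (d : Polynomial F) :
    (∃ s : Fin n → RatFunc F,
        algebraMap (Polynomial F) (RatFunc F) d = ∑ i, s i ^ 2) ↔
      ∃ s : Fin n → Polynomial F, d = ∑ i, s i ^ 2 := by
  constructor
  · rintro ⟨s, hs⟩
    obtain ⟨g, hg⟩ := IsLocalization.exist_integer_multiples_of_finite
      (nonZeroDivisors (Polynomial F)) s
    choose f hf using hg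
    refine cassels_descent (Ring.two_ne_zero h2) d _ (g : Polynomial F) f
      (nonZeroDivisors.ne_zero g.2) rfl ?_
    apply IsFractionRing.injective (Polynomial F) (RatFunc F)
    rw [map_mul, map_pow, hs, map_sum, Finset.mul_sum]
    refine Finset.sum_congr rfl fun i _ => ?_
    rw [map_pow, hf i, Algebra.smul_def, mul_pow]
  · rintro ⟨s, hs⟩
    refine ⟨fun i => algebraMap _ _ (s i), ?_⟩
    rw [hs]
    simp
end

section
/- Let (R, |·|) be a normed integral domain whose fraction field K has characteristic not 2, and let q be a quadratic form in n variables over R, nondegenerate over K. If q is Euclidean, then q is an ADC form. -/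
open scoped BigOperators

/-- Evaluation of the quadratic form with coefficient matrix `M`, after mapping
the coefficients through the ring homomorphism `φ`. -/
def quadEval {R S : Type*} [CommRing R] [CommRing S] (φ : R →+* S) {n : ℕ}
    (M : Matrix (Fin n) (Fin n) R) (x : Fin n → S) : S :=
  ∑ i, ∑ j, φ (M i j) * x i * x j

/-- `f : R → ℕ` is a norm on the integral domain `R`. -/
def IsNorm {R : Type*} [CommRing R] [IsDomain R] (f : R → ℕ) : Prop :=
  (∀ x, f x = 0 ↔ x = 0) ∧ (∀ x y, f (x * y) = f x * f y) ∧
    (∀ x, f x = 1 ↔ IsUnit x)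

/-- `N : K → ℚ` is the extension of the norm `f : R → ℕ` to the fraction field
`K`, given by `|a/b| = |a|/|b|`. -/
def IsNormExt {R K : Type*} [CommRing R] [IsDomain R] [Field K] [Algebra R K]
    (f : R → ℕ) (N : K → ℚ) : Prop :=
  ∀ a b : R, b ≠ 0 →
    N (algebraMap R K a / algebraMap R K b) = (f a : ℚ) / (f b : ℚ)

/-- A quadratic form (with coefficient matrix `M` over `R`) is Euclidean with
respect to the extended norm `N` on the fraction field `K` if for every
`x ∈ Kⁿ \ Rⁿ` there is `y ∈ Rⁿ` with `0 < |q(x - y)| < 1`. -/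
def IsEuclideanForm {R K : Type*} [CommRing R] [Field K] [Algebra R K]
    (N : K → ℚ) {n : ℕ} (M : Matrix (Fin n) (Fin n) R) : Prop :=
  ∀ x : Fin n → K, (¬ ∀ i, x i ∈ Set.range (algebraMap R K)) →
    ∃ y : Fin n → R,
      0 < N (quadEval (algebraMap R K) M (x - fun i => algebraMap R K (y i))) ∧
      N (quadEval (algebraMap R K) M (x - fun i => algebraMap R K (y i))) < 1

/-- A quadratic form over `R` is an ADC form if every `d ∈ R` represented by
the form over the fraction field `K` is represented over `R`. -/
def IsADCForm {R : Type*} (K : Type*) [CommRing R] [Field K] [Algebra R K]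
    {n : ℕ} (M : Matrix (Fin n) (Fin n) R) : Prop :=
  ∀ d : R, (∃ x : Fin n → K, quadEval (algebraMap R K) M x = algebraMap R K d) →
    ∃ y : Fin n → R, quadEval (RingHom.id R) M y = d

/-- The polar form of the quadratic form with coefficient matrix `M`. -/
def adcPolar {R : Type*} [CommRing R] {n : ℕ}
    (M : Matrix (Fin n) (Fin n) R) (x y : Fin n → R) : R :=
  ∑ i, ∑ j, (M i j * x i * y j + M i j * y i * x j)

lemma quadEval_comb {R : Type*} [CommRing R] {n : ℕ}
    (M : Matrix (Fin n) (Fin n) R) (x y : Fin n → R) (a b : R) :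
    quadEval (RingHom.id R) M (fun i => a * x i + b * y i) =
      a ^ 2 * quadEval (RingHom.id R) M x + a * b * adcPolar M x y
        + b ^ 2 * quadEval (RingHom.id R) M y := by
  simp only [quadEval, adcPolar, Finset.mul_sum, ← Finset.sum_add_distrib, RingHom.id_apply]
  refine Finset.sum_congr rfl fun i _ => Finset.sum_congr rfl fun j _ => ?_
  ring

lemma quadEval_div {R K : Type*} [CommRing R] [Field K] [Algebra R K] {n : ℕ}
    (M : Matrix (Fin n) (Fin n) R) (w : Fin n → R) (t : R) (z : Fin n → K)
    (hz : ∀ i, z i = algebraMap R K (w i) / algebraMap R K t) :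
    quadEval (algebraMap R K) M z =
      algebraMap R K (quadEval (RingHom.id R) M w) / algebraMap R K (t * t) := by
  simp only [quadEval, map_sum, map_mul, Finset.sum_div, RingHom.id_apply]
  refine Finset.sum_congr rfl fun i _ => Finset.sum_congr rfl fun j _ => ?_
  rw [hz, hz]
  ring

lemma adc_descent_s4 {R K : Type*} [CommRing R] [IsDomain R]
    [Field K] [Algebra R K] [IsFractionRing R K]
    (f : R → ℕ) (hf : IsNorm f) (N : K → ℚ) (hN : IsNormExt f N)
    {n : ℕ} (M : Matrix (Fin n) (Fin n) R)
    (hEuc : IsEuclideanForm N M) (d : R) :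
    ∀ (m : ℕ) (t : R) (x : Fin n → R), f t = m → t ≠ 0 →
      quadEval (RingHom.id R) M x = t ^ 2 * d →
      ∃ y : Fin n → R, quadEval (RingHom.id R) M y = d := by
  intro m
  induction m using Nat.strong_induction_on with
  | _ m ih =>
    intro t x hm ht hx
    have hinj := IsFractionRing.injective R K
    have htK : algebraMap R K t ≠ 0 := fun h => ht (hinj (by rw [h, map_zero]))
    by_cases hint : ∀ i, (algebraMap R K (x i) / algebraMap R K t) ∈ Set.range (algebraMap R K)
    · choose y hy using hint
      refine ⟨y, ?_⟩
      have hxy : x = fun i => t * y i + 0 * y i := by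
        funext i
        apply hinj
        have := hy i
        rw [eq_div_iff htK] at this
        simp only [zero_mul, add_zero, map_mul]
        rw [← this, mul_comm]
      rw [hxy, quadEval_comb] at hx
      have h : t ^ 2 * quadEval (RingHom.id R) M y = t ^ 2 * d := by linear_combination hx
      exact mul_left_cancel₀ (pow_ne_zero 2 ht) h
    · obtain ⟨y, h0, h1⟩ := hEuc (fun i => algebraMap R K (x i) / algebraMap R K t) hint
      set a := quadEval (RingHom.id R) M y - d with ha
      set b := 2 * d * t - adcPolar M x y with hb
      have hw := quadEval_comb M x y 1 (-t)
      have hwT : quadEval (RingHom.id R) M (fun i => 1 * x i + (-t) * y i) = t * (a * t + b) := by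
        rw [hw, hx, ha, hb]; ring
      rw [quadEval_div M (fun i => 1 * x i + (-t) * y i) t _ (by
        intro i
        simp only [Pi.sub_apply, map_add, map_mul, map_neg, map_one]
        field_simp
        ring), hwT, hN _ _ (mul_ne_zero ht ht), hf.2.1, hf.2.1] at h0 h1
      have hft : 0 < f t := Nat.pos_of_ne_zero fun h => ht ((hf.1 t).1 h)
      have hftq : (0 : ℚ) < f t := by exact_mod_cast hft
      have hT : a * t + b ≠ 0 := by
        intro h
        rw [h, (hf.1 0).2 rfl] at h0
        simp at h0
      have hlt : f (a * t + b) < f t := by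
        push_cast at h1
        rw [div_lt_one (by positivity)] at h1
        exact_mod_cast lt_of_mul_lt_mul_left h1 hftq.le
      refine ih _ (hm ▸ hlt) (a * t + b) (fun i => a * x i + b * y i) rfl hT ?_
      rw [quadEval_comb, hx]
      linear_combination (-(a * b)) * hb - b ^ 2 * ha

/-- **Euclidean implies ADC.** Let `(R, |·|)` be a normed integral domain whose
fraction field `K` has characteristic not `2`, and let `q` be a quadratic form
over `R`, nondegenerate over `K`.  If `q` is Euclidean, then `q` is an ADC
form. -/
theorem euclidean_implies_ADC {R K : Type*} [CommRing R] [IsDomain R]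
    [Field K] [Algebra R K] [IsFractionRing R K] (h2 : ringChar K ≠ 2)
    (f : R → ℕ) (hf : IsNorm f) (N : K → ℚ) (hN : IsNormExt f N)
    {n : ℕ} (M : Matrix (Fin n) (Fin n) R)
    (hnd : (M.map (algebraMap R K)).det ≠ 0)
    (hEuc : IsEuclideanForm N M) :
    IsADCForm K M := by
  intro d ⟨x, hx⟩
  obtain ⟨t, ht⟩ := IsLocalization.exist_integer_multiples_of_finite (nonZeroDivisors R) x
  choose w hw using ht
  have ht0 : (t : R) ≠ 0 := nonZeroDivisors.coe_ne_zero t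
  have hinj := IsFractionRing.injective R K
  have htK : algebraMap R K t ≠ 0 := fun h => ht0 (hinj (by rw [h, map_zero]))
  refine adc_descent_s4 f hf N hN M hEuc d _ t w rfl ht0 ?_
  rw [quadEval_div M w t x (by
    intro i
    rw [hw i, Algebra.smul_def, mul_div_cancel_left₀ _ htK]), map_mul,
    div_eq_iff (mul_ne_zero htK htK)] at hx
  apply hinj
  rw [hx]
  simp only [map_mul, map_pow]
  ring
end

section
/- Let n ≥ 1 and let a_1, …, a_n be positive integers. The integral quadratic form q(x) = a_1 x_1² + … + a_n x_n², over ℤ equipped with the usual absolute value as norm, is Euclidean if and only if a_1 + … + a_n < 4. -/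
open scoped BigOperators

theorem quadEval_diagonal_aux {n : ℕ} (a : Fin n → ℤ) (x : Fin n → ℚ) :
    quadEval (algebraMap ℤ ℚ) (Matrix.diagonal a) x = ∑ i, (a i : ℚ) * x i ^ 2 := by
  unfold quadEval
  refine Finset.sum_congr rfl fun i _ => ?_
  rw [Finset.sum_eq_single i]
  · simp; ring
  · intro j _ hj
    simp [Matrix.diagonal_apply_ne' _ hj]
  · simp

theorem half_sub_int_aux (y : ℤ) : (1 / 4 : ℚ) ≤ (1 / 2 - (y : ℚ)) ^ 2 := by
  have h : (0 : ℤ) ≤ y * (y - 1) := by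
    rcases le_or_gt y 0 with h | h
    · nlinarith
    · exact mul_nonneg h.le (by omega)
  have h' : (0 : ℚ) ≤ y * (y - 1) := by exact_mod_cast h
  nlinarith

/-- The diagonal integral quadratic form `q(x) = a₁x₁² + ⋯ + aₙxₙ²` with
positive integer coefficients, over `ℤ` with the usual absolute value as norm,
is Euclidean iff `a₁ + ⋯ + aₙ < 4`. -/
theorem diagonal_form_euclidean_iff {n : ℕ} (hn : 1 ≤ n) (a : Fin n → ℤ)
    (ha : ∀ i, 0 < a i) :
    IsEuclideanForm (K := ℚ) (fun x : ℚ => |x|) (Matrix.diagonal a) ↔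
      (∑ i, a i) < 4 := by
  simp only [IsEuclideanForm, quadEval_diagonal_aux, Pi.sub_apply, eq_intCast]
  have ha' : ∀ i, (0 : ℚ) < a i := fun i => by exact_mod_cast ha i
  constructor
  · intro h
    obtain ⟨y, -, hy⟩ := h (fun _ => 1 / 2) (by
      intro hx
      obtain ⟨m, hm⟩ := hx ⟨0, hn⟩
      have h1 : (m : ℚ) = 1 / 2 := by simpa using hm
      have h2 : ((2 * m : ℤ) : ℚ) = (1 : ℤ) := by push_cast; rw [h1]; norm_num
      have h3 : 2 * m = 1 := by exact_mod_cast h2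
      omega)
    have h1 := (le_abs_self _).trans_lt hy
    have h2 : ∑ i, (a i : ℚ) * (1 / 4) ≤ ∑ i, (a i : ℚ) * (1 / 2 - (y i : ℚ)) ^ 2 :=
      Finset.sum_le_sum fun i _ =>
        mul_le_mul_of_nonneg_left (half_sub_int_aux (y i)) (ha' i).le
    rw [← Finset.sum_mul] at h2
    have h3 : (∑ i, (a i : ℚ)) < 4 := by linarith
    exact_mod_cast h3
  · intro h x hx
    refine ⟨fun i => round (x i), ?_⟩
    have hs : (∑ i, (a i : ℚ)) < 4 := by exact_mod_cast h
    have hnn : ∀ i, 0 ≤ (a i : ℚ) * (x i - (round (x i) : ℚ)) ^ 2 := fun i =>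
      mul_nonneg (ha' i).le (sq_nonneg _)
    rw [abs_of_nonneg (Finset.sum_nonneg fun i _ => hnn i)]
    constructor
    · push Not at hx
      obtain ⟨i, hi⟩ := hx
      refine Finset.sum_pos' (fun i _ => hnn i) ⟨i, Finset.mem_univ _, ?_⟩
      refine mul_pos (ha' i) (sq_pos_of_ne_zero ?_)
      intro h0
      exact hi ⟨round (x i), by simpa using (sub_eq_zero.mp h0).symm⟩
    · have h2 : ∑ i, (a i : ℚ) * (x i - (round (x i) : ℚ)) ^ 2 ≤ ∑ i, (a i : ℚ) * (1 / 4) :=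
        Finset.sum_le_sum fun i _ => by
          refine mul_le_mul_of_nonneg_left ?_ (ha' i).le
          have h4 := abs_le.mp (abs_sub_round (x i))
          nlinarith [h4.1, h4.2]
      rw [← Finset.sum_mul] at h2
      linarith
end

section
/- Let R be an infinite integral domain, not a field, such that R/I is finite for every nonzero ideal I of R. If I is a nonzero ideal of R that is invertible (as a fractional ideal) and J is any nonzero ideal of R, then the cardinality of R/(I·J) equals the product of the cardinalities of R/I and R/J. -/
/-- **Multiplicativity of the ideal norm on invertible ideals.**  Let `R` be an
infinite integral domain, not a field, all of whose proper quotients are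
finite (a finite quotient domain).  If `I` is a nonzero invertible ideal and
`J` a nonzero ideal, then `#(R/IJ) = #(R/I) · #(R/J)`. -/
theorem card_quotient_mul_of_invertible {R : Type*} [CommRing R] [IsDomain R]
    [Infinite R] (hRfield : ¬ IsField R)
    (hfin : ∀ I : Ideal R, I ≠ ⊥ → Finite (R ⧸ I))
    (I J : Ideal R) (hI : I ≠ ⊥) (hJ : J ≠ ⊥)
    (hinv : IsUnit (I : FractionalIdeal (nonZeroDivisors R) (FractionRing R))) :
    Nat.card (R ⧸ (I * J)) = Nat.card (R ⧸ I) * Nat.card (R ⧸ J) := by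
  have := hfin J hJ
  let K := FractionRing R
  let u : (Submodule R K)ˣ :=
    hinv.unit.map (FractionalIdeal.coeSubmoduleHom (nonZeroDivisors R) K).toMonoidHom
  have hu : (u : Submodule R K) = IsLocalization.coeSubmodule K I := rfl
  let e₀ : I ≃ₗ[R] (u : Submodule R K) :=
    Submodule.equivMapOfInjective (Algebra.linearMap R K) (IsFractionRing.injective R K) I
  have : Module.Invertible R I := Module.Invertible.congr e₀.symm
  obtain ⟨e⟩ := (Module.Invertible.free_iff_linearEquiv (R := R ⧸ J)
    (M := TensorProduct R (R ⧸ J) I)).1 inferInstance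
  have h1 : Nat.card (I ⧸ (J • (⊤ : Submodule R I))) = Nat.card (R ⧸ J) :=
    Nat.card_congr ((TensorProduct.quotTensorEquivQuotSMul I J).symm.toEquiv.trans e.toEquiv)
  have h2 : (J • (⊤ : Submodule R I)) = Submodule.comap I.subtype (I * J) := by
    apply Submodule.map_injective_of_injective I.injective_subtype
    rw [Submodule.map_comap_eq, Submodule.map_smul'', Submodule.map_top, Submodule.range_subtype,
      smul_eq_mul, mul_comm J I, inf_eq_right.2 Ideal.mul_le_left]
  have h3 := AddSubgroup.relIndex_mul_index (H := (I * J).toAddSubgroup) (K := I.toAddSubgroup)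
    (Ideal.mul_le_left : I * J ≤ I)
  rw [h2] at h1
  rw [← h1, mul_comm (Nat.card _)]
  exact h3.symm
end

section
/- Let q be an anisotropic quadratic form in n variables over a field k. Then q remains anisotropic over the rational function field k(t): if x ∈ k(t)ⁿ satisfies q(x) = 0, then x = 0. -/
open scoped BigOperators

theorem quadEval_smul_aux {R S : Type*} [CommRing R] [CommRing S] (φ : R →+* S) {n : ℕ}
    (M : Matrix (Fin n) (Fin n) R) (c : S) (x : Fin n → S) :
    quadEval φ M (fun i => c * x i) = c ^ 2 * quadEval φ M x := by
  simp only [quadEval, Finset.mul_sum]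
  refine Finset.sum_congr rfl fun i _ => Finset.sum_congr rfl fun j _ => ?_
  ring

theorem map_quadEval_aux {R S T : Type*} [CommRing R] [CommRing S] [CommRing T] (φ : R →+* S)
    (ψ : S →+* T) {n : ℕ} (M : Matrix (Fin n) (Fin n) R) (x : Fin n → S) :
    ψ (quadEval φ M x) = quadEval (ψ.comp φ) M (fun i => ψ (x i)) := by
  simp [quadEval, map_sum]

theorem anisotropic_poly_aux {k : Type*} [Field k] {n : ℕ}
    (M : Matrix (Fin n) (Fin n) k)
    (hani : ∀ x : Fin n → k, quadEval (RingHom.id k) M x = 0 → x = 0)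
    (p : Fin n → Polynomial k) (hp : quadEval Polynomial.C M p = 0) : p = 0 := by
  have key : ∀ m : ℕ, ∀ i, (Polynomial.X : Polynomial k) ^ m ∣ p i := by
    intro m
    induction m with
    | zero => intro i; simp
    | succ m ih =>
      choose r hr using ih
      have h1 : p = fun i => Polynomial.X ^ m * r i := funext hr
      rw [h1, quadEval_smul_aux] at hp
      have h2 : quadEval Polynomial.C M r = 0 :=
        (mul_eq_zero.mp hp).resolve_left (pow_ne_zero _ (pow_ne_zero _ Polynomial.X_ne_zero))
      have h3 := congrArg (Polynomial.evalRingHom (0 : k)) h2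
      rw [map_quadEval_aux, map_zero] at h3
      have h4 : (Polynomial.evalRingHom (0 : k)).comp Polynomial.C = RingHom.id k := by
        ext a; simp
      rw [h4] at h3
      have h5 := hani _ h3
      intro i
      rw [hr i, pow_succ]
      refine mul_dvd_mul_left _ ?_
      rw [Polynomial.X_dvd_iff, Polynomial.coeff_zero_eq_eval_zero]
      exact congrFun h5 i
  funext i
  ext m
  exact Polynomial.X_pow_dvd_iff.mp (key (m + 1) i) m (Nat.lt_succ_self m)

/-- An anisotropic quadratic form over a field `k` remains anisotropic over the
rational function field `k(t)`. -/
theorem anisotropic_over_ratFunc {k : Type*} [Field k] {n : ℕ}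
    (M : Matrix (Fin n) (Fin n) k)
    (hani : ∀ x : Fin n → k, quadEval (RingHom.id k) M x = 0 → x = 0) :
    ∀ x : Fin n → RatFunc k,
      quadEval (algebraMap k (RatFunc k)) M x = 0 → x = 0 := by
  intro x hx
  obtain ⟨b, hb⟩ := IsLocalization.exist_integer_multiples_of_finite
    (nonZeroDivisors (Polynomial k)) x
  choose p hp using hb
  have hinj : Function.Injective (algebraMap (Polynomial k) (RatFunc k)) :=
    IsFractionRing.injective _ _
  have hb0 : algebraMap (Polynomial k) (RatFunc k) (b : Polynomial k) ≠ 0 := by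
    rw [Ne, map_eq_zero_iff _ hinj]
    exact nonZeroDivisors.ne_zero b.2
  have hp' : (fun i => algebraMap (Polynomial k) (RatFunc k) (p i)) =
      fun i => algebraMap (Polynomial k) (RatFunc k) (b : Polynomial k) * x i := by
    funext i
    rw [hp i, Algebra.smul_def]
  have h0 : quadEval Polynomial.C M p = 0 := by
    apply hinj
    rw [map_quadEval_aux, map_zero, hp', quadEval_smul_aux]
    have : (algebraMap (Polynomial k) (RatFunc k)).comp Polynomial.C =
        algebraMap k (RatFunc k) := by
      ext a; simp
    rw [this, hx, mul_zero]
  have h1 := anisotropic_poly_aux M hani p h0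
  funext i
  have h2 := congrFun hp' i
  simp only [h1, Pi.zero_apply, map_zero] at h2
  exact (mul_eq_zero.mp h2.symm).resolve_left hb0
end

section
/- Let F be a field of characteristic not 2, R = F[t], K = F(t), and let q = Σ_{1≤i,j≤n} a_ij(t) x_i x_j be a quadratic form over R with symmetric coefficient matrix (a_ij(t)), nondegenerate over K. Suppose either (i) q is anisotropic over K and each a_ij has degree at most 1, or (ii) each a_ij has degree 0, i.e., q is the extension of a quadratic form over F. Then q is an ADC form over R. -/
open scoped BigOperators

open Polynomial in
theorem gcp_expand {R : Type*} [CommRing R] {n : ℕ} (M : Matrix (Fin n) (Fin n) R)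
    (hs : M.IsSymm) (a b : R) (x y : Fin n → R) :
    (a • x + b • y) ⬝ᵥ M.mulVec (a • x + b • y) =
      a ^ 2 * (x ⬝ᵥ M.mulVec x) + 2 * a * b * (x ⬝ᵥ M.mulVec y) + b ^ 2 * (y ⬝ᵥ M.mulVec y) := by
  have h : y ⬝ᵥ M.mulVec x = x ⬝ᵥ M.mulVec y := by
    rw [Matrix.dotProduct_mulVec, ← Matrix.mulVec_transpose, hs.eq, dotProduct_comm]
  simp only [Matrix.mulVec_add, Matrix.mulVec_smul, dotProduct_add, add_dotProduct,
    smul_dotProduct, dotProduct_smul, smul_eq_mul, h]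
  ring

theorem gcp_quadEval {R S : Type*} [CommRing R] [CommRing S] (φ : R →+* S) {n : ℕ}
    (M : Matrix (Fin n) (Fin n) R) (x : Fin n → S) :
    quadEval φ M x = x ⬝ᵥ (M.map φ).mulVec x := by
  simp only [quadEval, dotProduct, Matrix.mulVec, Finset.mul_sum, Matrix.map_apply]
  refine Finset.sum_congr rfl fun i _ => Finset.sum_congr rfl fun j _ => ?_
  ring

theorem gcp_map {R S : Type*} [CommRing R] [CommRing S] (φ : R →+* S) {n : ℕ}
    (M : Matrix (Fin n) (Fin n) R) (x : Fin n → R) :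
    (fun i => φ (x i)) ⬝ᵥ (M.map φ).mulVec (fun i => φ (x i)) = φ (x ⬝ᵥ M.mulVec x) := by
  simp [dotProduct, Matrix.mulVec, map_sum]

open Polynomial in
theorem gcp_descent {F : Type*} [Field F] {n : ℕ} (M : Matrix (Fin n) (Fin n) F[X])
    (hs : M.IsSymm) (hD : ∀ i j, (M i j).natDegree ≤ 1)
    (hA : ∀ x : Fin n → F[X], x ⬝ᵥ M.mulVec x = 0 → x = 0) (d : F[X]) :
    ∀ (N : ℕ) (f : F[X]) (x : Fin n → F[X]), f.natDegree = N → f ≠ 0 →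
      x ⬝ᵥ M.mulVec x = d * f ^ 2 → ∃ y : Fin n → F[X], y ⬝ᵥ M.mulVec y = d := by
  intro N
  induction N using Nat.strong_induction_on with
  | _ N ih =>
  intro f x hN hf hx
  set y : Fin n → F[X] := fun i => x i / f with hy
  set r : Fin n → F[X] := fun i => x i % f with hr
  have hxr : r = (1 : F[X]) • x + (-f) • y := by
    funext i
    have := EuclideanDomain.div_add_mod (x i) f
    simp only [hr, hy, Pi.add_apply, Pi.smul_apply, smul_eq_mul]
    linear_combination this
  by_cases hr0 : r = 0
  · refine ⟨y, ?_⟩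
    have hxy : x = f • y + (0 : F[X]) • y := by
      funext i
      have := congrFun (hxr.symm.trans hr0) i
      simp only [Pi.add_apply, Pi.smul_apply, smul_eq_mul, Pi.zero_apply] at this ⊢
      linear_combination this
    rw [hxy, gcp_expand M hs] at hx
    apply mul_left_cancel₀ (pow_ne_zero 2 hf)
    linear_combination hx
  · have hN0 : f.natDegree ≠ 0 := by
      intro h0
      apply hr0
      funext i
      have h1 : (x i % f).degree < f.degree := EuclideanDomain.mod_lt _ hf
      rw [degree_eq_natDegree hf, h0] at h1
      exact degree_eq_bot.mp (Nat.WithBot.lt_zero_iff.mp h1)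
    set g := d * f - 2 * (x ⬝ᵥ M.mulVec y) + f * (y ⬝ᵥ M.mulVec y) with hg
    have hqr : r ⬝ᵥ M.mulVec r = f * g := by
      rw [hxr, gcp_expand M hs, hx, hg]; ring
    have hg0 : g ≠ 0 := by
      intro h0
      rw [h0, mul_zero] at hqr
      exact hr0 (hA r hqr)
    have hdeg : (r ⬝ᵥ M.mulVec r).natDegree ≤ (N - 1) + (1 + (N - 1)) := by
      have hri : ∀ i, (r i).natDegree ≤ N - 1 := fun i => by
        have := natDegree_mod_lt (x i) hN0
        simp only [hr]; omega
      simp only [dotProduct, Matrix.mulVec]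
      refine natDegree_sum_le_of_forall_le _ _ fun i _ => natDegree_mul_le_of_le (hri i) ?_
      exact natDegree_sum_le_of_forall_le _ _ fun j _ => natDegree_mul_le_of_le (hD i j) (hri j)
    rw [hqr, natDegree_mul hf hg0] at hdeg
    refine ih g.natDegree (by omega) g
      (((y ⬝ᵥ M.mulVec y) - d) • x + (2 * (d * f - x ⬝ᵥ M.mulVec y)) • y) rfl hg0 ?_
    rw [gcp_expand M hs, hx, hg]
    ring

open Polynomial in
theorem gcp_isotropic {F : Type*} [Field F] (h2 : (2 : F) ≠ 0) {n : ℕ}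
    (M : Matrix (Fin n) (Fin n) F[X]) (hs : M.IsSymm) (hdet : M.det ≠ 0)
    (hD : ∀ i j, (M i j).natDegree ≤ 0)
    (r : Fin n → F[X]) (hr : r ≠ 0) (hq : r ⬝ᵥ M.mulVec r = 0) (d : F[X]) :
    ∃ y : Fin n → F[X], y ⬝ᵥ M.mulVec y = d := by
  set M0 : Matrix (Fin n) (Fin n) F := M.map (fun p => p.coeff 0) with hM0
  have hM : M = M0.map C := by
    ext1 i j
    simpa [hM0] using eq_C_of_natDegree_le_zero (hD i j)
  have hdet0 : M0.det ≠ 0 := by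
    intro h
    apply hdet
    have := (C : F →+* F[X]).map_det M0
    rw [h, map_zero] at this
    rw [hM]; exact this.symm
  obtain ⟨i0, hi0⟩ := Function.ne_iff.mp hr
  obtain ⟨k, -, hk⟩ := Finset.exists_max_image Finset.univ (fun i => (r i).degree)
    ⟨i0, Finset.mem_univ _⟩
  have hk0 : r k ≠ 0 := by
    intro h
    have := hk i0 (Finset.mem_univ _)
    simp only [h, degree_zero, le_bot_iff, degree_eq_bot] at this
    exact hi0 this
  set N := (r k).natDegree with hN
  have hle : ∀ i, (r i).natDegree ≤ N := fun i => natDegree_le_natDegree (hk i (Finset.mem_univ _))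
  set v : Fin n → F := fun i => (r i).coeff N with hv
  have hv0 : v ≠ 0 := fun h => hk0 (leadingCoeff_eq_zero.mp (congrFun h k))
  have hqv : v ⬝ᵥ M0.mulVec v = 0 := by
    have h := congrArg (fun p => p.coeff (N + (0 + N))) hq
    simp only [dotProduct, Matrix.mulVec, finsetSum_coeff, coeff_zero] at h
    rw [← h]
    simp only [dotProduct, Matrix.mulVec]
    refine Finset.sum_congr rfl fun i _ => ?_
    rw [coeff_mul_add_eq_of_natDegree_le (hle i)
      (natDegree_sum_le_of_forall_le _ _ fun j _ => natDegree_mul_le_of_le (hD i j) (hle j)),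
      finsetSum_coeff]
    congr 1
    refine Finset.sum_congr rfl fun j _ => ?_
    rw [coeff_mul_add_eq_of_natDegree_le (hD i j) (hle j)]
    rfl
  have hMv : M0.mulVec v ≠ 0 := fun h => hv0 (Matrix.eq_zero_of_mulVec_eq_zero hdet0 h)
  obtain ⟨j, hj⟩ := Function.ne_iff.mp hMv
  simp only [Pi.zero_apply] at hj
  set V : Fin n → F[X] := fun i => C (v i) with hV
  set W : Fin n → F[X] := Pi.single j 1 with hW
  have hVV : V ⬝ᵥ M.mulVec V = 0 := by
    have := gcp_map (C : F →+* F[X]) M0 v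
    rw [hqv, map_zero] at this
    rw [hM]; exact this
  have hWV : W ⬝ᵥ M.mulVec V = C (M0.mulVec v j) := by
    rw [hW, single_one_dotProduct, hM]
    simp [Matrix.mulVec, dotProduct, hV, map_sum]
  set c := M0.mulVec v j
  refine ⟨(1 : F[X]) • W + (C ((2 * c)⁻¹) * (d - W ⬝ᵥ M.mulVec W)) • V, ?_⟩
  rw [gcp_expand M hs, hVV, hWV]
  have hc : (2 : F[X]) * C c * C ((2 * c)⁻¹) = 1 := by
    have : (2 : F[X]) = C 2 := (map_ofNat C 2).symm
    rw [this, ← C_mul, ← C_mul, mul_inv_cancel₀ (mul_ne_zero h2 hj), C_1]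
  linear_combination (d - W ⬝ᵥ M.mulVec W) * hc

/-- **Generalized Cassels–Pfister Theorem.**  Let `F` be a field of
characteristic not `2`, `R = F[t]`, `K = F(t)`, and `q = ∑ᵢⱼ aᵢⱼ(t) xᵢ xⱼ` a
quadratic form over `R` with symmetric coefficient matrix, nondegenerate over
`K`.  If either (i) `q` is anisotropic over `K` and each `aᵢⱼ` has degree at
most `1`, or (ii) each `aᵢⱼ` has degree `0`, then `q` is an ADC form. -/
theorem generalized_cassels_pfister {F : Type*} [Field F] (h2 : ringChar F ≠ 2)
    {n : ℕ} (M : Matrix (Fin n) (Fin n) (Polynomial F)) (hsymm : M.IsSymm)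
    (hnd : (M.map (algebraMap (Polynomial F) (RatFunc F))).det ≠ 0)
    (h : ((∀ x : Fin n → RatFunc F,
            quadEval (algebraMap (Polynomial F) (RatFunc F)) M x = 0 → x = 0) ∧
          ∀ i j, (M i j).degree ≤ 1) ∨
        (∀ i j, (M i j).degree ≤ 0)) :
    IsADCForm (RatFunc F) M := by
  classical
  have h2' : (2 : F) ≠ 0 := Ring.two_ne_zero h2
  have hinj : Function.Injective (algebraMap (Polynomial F) (RatFunc F)) :=
    IsFractionRing.injective _ _
  have hdet : M.det ≠ 0 := by
    intro h0
    apply hnd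
    have := (algebraMap (Polynomial F) (RatFunc F)).map_det M
    rw [h0, map_zero] at this
    exact this.symm
  intro d hd
  obtain ⟨x, hx⟩ := hd
  have hid : ∀ y : Fin n → Polynomial F,
      quadEval (RingHom.id (Polynomial F)) M y = y ⬝ᵥ M.mulVec y := fun y => by
    rw [gcp_quadEval]; rfl
  simp only [hid]
  obtain ⟨b, hb⟩ := IsLocalization.exist_integer_multiples_of_finite
    (nonZeroDivisors (Polynomial F)) x
  choose z hz using hb
  have hf : (b : Polynomial F) ≠ 0 := nonZeroDivisors.coe_ne_zero b
  have hzq : z ⬝ᵥ M.mulVec z = d * (b : Polynomial F) ^ 2 := by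
    apply hinj
    rw [← gcp_map, map_mul, map_pow, ← hx, gcp_quadEval]
    have : (fun i => algebraMap (Polynomial F) (RatFunc F) (z i)) =
        (algebraMap (Polynomial F) (RatFunc F) b) • x := by
      funext i
      rw [hz i, Algebra.smul_def]; rfl
    rw [this, Matrix.mulVec_smul, dotProduct_smul, smul_dotProduct, smul_eq_mul, smul_eq_mul]
    ring
  have hfin : (∀ i j, (M i j).natDegree ≤ 1) →
      (∀ x : Fin n → Polynomial F, x ⬝ᵥ M.mulVec x = 0 → x = 0) →
      ∃ y : Fin n → Polynomial F, y ⬝ᵥ M.mulVec y = d := fun hD hA =>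
    gcp_descent M hsymm hD hA d _ b z rfl hf hzq
  rcases h with ⟨hA, hD⟩ | hD
  · refine hfin (fun i j => Polynomial.natDegree_le_of_degree_le (hD i j)) fun w hw => ?_
    have := hA (fun i => algebraMap (Polynomial F) (RatFunc F) (w i)) (by
      rw [gcp_quadEval, gcp_map, hw, map_zero])
    funext i
    exact hinj (by simpa using congrFun this i)
  · have hD' : ∀ i j, (M i j).natDegree ≤ 0 := fun i j =>
      Polynomial.natDegree_le_of_degree_le (hD i j)
    by_cases hA : ∀ x : Fin n → Polynomial F, x ⬝ᵥ M.mulVec x = 0 → x = 0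
    · exact hfin (fun i j => (hD' i j).trans zero_le_one) hA
    · push Not at hA
      obtain ⟨w, hw, hw0⟩ := hA
      exact gcp_isotropic h2' M hsymm hdet hD' w hw0 hw d
end

section
/- Let (R, |·|) be a normed integral domain with fraction field K and let q be a Euclidean quadratic form in n variables over R. Then the quadratic R-lattice Rⁿ ⊆ Kⁿ is maximal: there is no R-submodule Λ of Kⁿ with Rⁿ ⊊ Λ and q(Λ) ⊆ R. -/
open scoped BigOperators

/-- **A Euclidean form has maximal standard lattice.**  If `q` is a Euclidean
quadratic form over a normed domain `(R, |·|)`, then the lattice `Rⁿ ⊆ Kⁿ` is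
maximal: there is no `R`-submodule `Λ` of `Kⁿ` strictly containing `Rⁿ` with
`q(Λ) ⊆ R`. -/
theorem euclidean_form_lattice_maximal {R K : Type*} [CommRing R] [IsDomain R]
    [Field K] [Algebra R K] [IsFractionRing R K]
    (f : R → ℕ) (hf : IsNorm f) (N : K → ℚ) (hN : IsNormExt f N)
    {n : ℕ} (M : Matrix (Fin n) (Fin n) R)
    (hEuc : IsEuclideanForm N M) :
    ¬ ∃ Λ : Submodule R (Fin n → K),
        (Submodule.pi Set.univ fun _ : Fin n =>
          LinearMap.range (Algebra.linearMap R K)) < Λ ∧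
        ∀ x ∈ Λ, quadEval (algebraMap R K) M x ∈ Set.range (algebraMap R K) := by
  rintro ⟨Λ, hlt, hq⟩
  obtain ⟨hle, x, hx, hx'⟩ := Set.ssubset_iff_exists.mp (SetLike.coe_ssubset_coe.mpr hlt)
  have hxn : ¬ ∀ i, x i ∈ Set.range (algebraMap R K) := by
    intro h
    apply hx'
    rw [SetLike.mem_coe, Submodule.mem_pi]
    intro i _
    obtain ⟨r, hr⟩ := h i
    exact ⟨r, hr⟩
  obtain ⟨y, h0, h1⟩ := hEuc x hxn
  have hy : (fun i => algebraMap R K (y i)) ∈ Λ := by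
    apply hle
    rw [SetLike.mem_coe, Submodule.mem_pi]
    intro i _
    exact ⟨y i, rfl⟩
  obtain ⟨r, hr⟩ := hq _ (Λ.sub_mem hx hy)
  have h1f : f 1 = 1 := (hf.2.2 1).2 isUnit_one
  have h := hN r 1 one_ne_zero
  rw [map_one, div_one, h1f, Nat.cast_one, div_one] at h
  rw [← hr, h] at h0 h1
  have h0' : 0 < f r := by exact_mod_cast h0
  have h1' : f r < 1 := by exact_mod_cast h1
  omega
end

section
/- Let R be an integral domain with fraction field K, let S ⊆ R \ {0} be a multiplicatively closed subset containing 1, and let R_S = S⁻¹R ⊆ K. If a quadratic form q in n variables over R is an ADC form over R, then q, viewed as a quadratic form over R_S, is an ADC form over R_S. -/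
open scoped BigOperators

theorem quadEval_map_aux {R S : Type*} [CommRing R] [CommRing S] (φ : R →+* S) {n : ℕ}
    (M : Matrix (Fin n) (Fin n) R) (y : Fin n → R) :
    quadEval φ M (fun i => φ (y i)) = φ (quadEval (RingHom.id R) M y) := by
  simp [quadEval, map_sum]

/-- **The ADC property localizes.**  Let `R` be an integral domain with
fraction field `K`, `S ⊆ R \ {0}` a multiplicatively closed subset containing
`1`, and `A = S⁻¹R` the localization (viewed inside `K`).  If a quadratic form
`q` over `R` is ADC, then `q` viewed over `A` is ADC. -/
theorem ADC_localizes {R K A : Type*} [CommRing R] [IsDomain R]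
    [Field K] [Algebra R K] [IsFractionRing R K]
    (S : Submonoid R) (hS0 : (0 : R) ∉ S)
    [CommRing A] [Algebra R A] [IsLocalization S A]
    [Algebra A K] [IsScalarTower R A K] [IsFractionRing A K]
    {n : ℕ} (M : Matrix (Fin n) (Fin n) R)
    (hADC : IsADCForm K M) :
    ∀ d : A, (∃ x : Fin n → K,
        quadEval (algebraMap R K) M x = algebraMap A K d) →
      ∃ y : Fin n → A, quadEval (algebraMap R A) M y = d := by
  rintro d ⟨x, hx⟩
  obtain ⟨⟨a, s⟩, hs⟩ := IsLocalization.surj S d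
  simp only at hs
  obtain ⟨u, hu⟩ := (IsLocalization.map_units A s).exists_right_inv
  obtain ⟨y, hy⟩ := hADC (a * s) ⟨fun i => algebraMap R K s * x i, by
    rw [quadEval_smul_aux, hx, map_mul, IsScalarTower.algebraMap_apply R A K a, ← hs,
      map_mul, IsScalarTower.algebraMap_apply R A K s]
    ring⟩
  refine ⟨fun i => u * algebraMap R A (y i), ?_⟩
  rw [quadEval_smul_aux, quadEval_map_aux, hy, map_mul, ← hs]
  linear_combination d * (algebraMap R A s * u + 1) * hu
end

section
/- Let R be a unique factorization domain with fraction field K of characteristic not 2, and let a ∈ R be nonzero. The one-variable quadratic form q(x) = a x² is an ADC form over R if and only if a is squarefree. -/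
/-- **Unary ADC forms over a UFD.**  Let `R` be a UFD with fraction field `K`
of characteristic not `2` and `a ∈ R` nonzero.  The one-variable quadratic
form `q(x) = a x²` is an ADC form over `R` iff `a` is squarefree. -/
theorem unary_ADC_iff_squarefree {R K : Type*} [CommRing R] [IsDomain R]
    [UniqueFactorizationMonoid R] [Field K] [Algebra R K] [IsFractionRing R K]
    (h2 : ringChar K ≠ 2) (a : R) (ha : a ≠ 0) :
    (∀ d : R, (∃ x : K, algebraMap R K a * x ^ 2 = algebraMap R K d) →
      ∃ y : R, a * y ^ 2 = d) ↔ Squarefree a := by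
  have hinj := IsFractionRing.injective R K
  constructor
  · rintro h b ⟨c, hc⟩
    have hb : b ≠ 0 := by rintro rfl; simp at hc; exact ha hc
    have hc0 : c ≠ 0 := by rintro rfl; simp at hc; exact ha hc
    have hbK : algebraMap R K b ≠ 0 := fun h0 => hb (hinj (by simpa using h0))
    obtain ⟨y, hy⟩ := h c ⟨(algebraMap R K b)⁻¹, by
      rw [hc]; simp only [map_mul]; field_simp⟩
    have h1 : b * (b * y ^ 2) = 1 := by
      apply mul_left_cancel₀ hc0
      rw [hc] at hy
      linear_combination hy
    exact IsUnit.of_mul_eq_one _ h1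
  · rintro h d ⟨x, hx⟩
    obtain ⟨p, q, hpq, rfl⟩ := IsFractionRing.exists_reduced_fraction (A := R) x
    have hq : (q : R) ≠ 0 := nonZeroDivisors.coe_ne_zero q
    have hqK : algebraMap R K q ≠ 0 := fun h0 => hq (hinj (by simpa using h0))
    have e : a * p ^ 2 = d * (q : R) ^ 2 := by
      apply hinj
      rw [IsFractionRing.mk'_eq_div] at hx
      simp only [map_mul, map_pow]
      rw [← hx]
      field_simp
    have hdvd : (q : R) ^ 2 ∣ a :=
      (hpq.symm.pow (m := 2) (n := 2)).dvd_of_dvd_mul_right ⟨d, by rw [e]; ring⟩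
    have hu : IsUnit (q : R) := h _ (by rwa [← pow_two])
    obtain ⟨r, hr⟩ := hu.exists_right_inv
    refine ⟨p * r, ?_⟩
    calc a * (p * r) ^ 2 = (a * p ^ 2) * r ^ 2 := by ring
      _ = d * ((q : R) * r) ^ 2 := by rw [e]; ring
      _ = d := by rw [hr]; ring
end
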